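/- In any alternative algebra over a field of characteristic 0, (a^2, x, [[a,z], y]) = (a, x, [[a^2,z], y]), where [a,b] = ab - ba and (x,y,z) = (xy)z - x(yz). -/

import Mathlib

variable {A : Type*} [NonUnitalNonAssocRing A]

/-- Commutator `[x,y] = xy - yx`. -/
def altComm (x y : A) : A := x * y - y * x

/-- Associator `(x,y,z) = (xy)z - x(yz)`. -/
def altAssoc (x y z : A) : A := (x * y) * z - x * (y * z)

/-- Jordan product `x ∘ y = xy + yx`. -/
def altSop (x y : A) : A := x * y + y * x

/-- Jacobian `J(a,b,c) = [[a,b],c] + [[b,c],a] + [[c,a],b]`. -/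
def altJac (x y z : A) : A := altComm (altComm x y) z + altComm (altComm y z) x + altComm (altComm z x) y

/-- `D(a,b,c) = (a∘b)∘c - (a∘c)∘b`. -/
def altDop (x y z : A) : A := altSop (altSop x y) z - altSop (altSop x z) y

section helpers

theorem altAssoc_add1 (a b c d : A) : altAssoc (a + b) c d = altAssoc a c d + altAssoc b c d := by
  simp only [altAssoc, add_mul]; abel
theorem altAssoc_add2 (a b c d : A) : altAssoc c (a + b) d = altAssoc c a d + altAssoc c b d := by
  simp only [altAssoc, add_mul, mul_add]; abel
theorem altAssoc_add3 (a b c d : A) : altAssoc c d (a + b) = altAssoc c d a + altAssoc c d b := by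
  simp only [altAssoc, mul_add]; abel
theorem altAssoc_sub3 (a b c d : A) : altAssoc c d (a - b) = altAssoc c d a - altAssoc c d b := by
  simp only [altAssoc, mul_sub]; abel

/-- Teichmüller identity. -/
theorem altTeich (w x y z : A) : altAssoc (w * x) y z - altAssoc w (x * y) z + altAssoc w x (y * z)
    = w * altAssoc x y z + altAssoc w x y * z := by
  simp only [altAssoc, mul_sub, sub_mul]; abel

theorem alt_s12
    (hl : ∀ x y : A, altAssoc x x y = 0)
    (x y z : A) : altAssoc x y z = - altAssoc y x z := by
  have h := hl (x + y) z
  rw [altAssoc_add1, altAssoc_add2, altAssoc_add2, hl, hl, zero_add, add_zero] at h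
  exact eq_neg_of_add_eq_zero_left h

theorem alt_s23
    (hr : ∀ x y : A, altAssoc y x x = 0)
    (x y z : A) : altAssoc x y z = - altAssoc x z y := by
  have h := hr (y + z) x
  rw [altAssoc_add3, altAssoc_add2, altAssoc_add2, hr, hr, zero_add, add_zero] at h
  exact eq_neg_of_add_eq_zero_right h

theorem alt_cyc
    (hl : ∀ x y : A, altAssoc x x y = 0) (hr : ∀ x y : A, altAssoc y x x = 0)
    (x y z : A) : altAssoc x y z = altAssoc y z x := by
  rw [alt_s12 hl, alt_s23 hr, neg_neg]

/-- Kleinfeld function. -/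
def altKf (w x y z : A) : A := altAssoc (w * x) y z - x * altAssoc w y z - altAssoc x y z * w

theorem altKf_F
    (hl : ∀ x y : A, altAssoc x x y = 0) (hr : ∀ x y : A, altAssoc y x x = 0)
    (w x y z : A) : altKf w x y z - altKf x y z w + altKf y z w x =
    altComm w (altAssoc x y z) - altComm x (altAssoc y z w) + altComm y (altAssoc z w x)
      - altComm z (altAssoc w x y) := by
  have h := altTeich w x y z
  rw [alt_cyc hl hr w (x * y) z, ← alt_cyc hl hr (y * z) w x] at h
  have e1 : altAssoc w y z = altAssoc y z w := alt_cyc hl hr _ _ _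
  have e2 : altAssoc x z w = altAssoc z w x := alt_cyc hl hr _ _ _
  have e3 : altAssoc y w x = altAssoc w x y := alt_cyc hl hr _ _ _
  simp only [altKf, altComm, e1, e2, e3]
  linear_combination (norm := abel) h

theorem altKf_cyc
    (hl : ∀ x y : A, altAssoc x x y = 0) (hr : ∀ x y : A, altAssoc y x x = 0)
    (w x y z : A) : altKf w x y z = - altKf z w x y := by
  have h1 := altKf_F hl hr w x y z
  have h2 := altKf_F hl hr x y z w
  linear_combination (norm := abel) h1 + h2

theorem altKf_34
    (hl : ∀ x y : A, altAssoc x x y = 0) (hr : ∀ x y : A, altAssoc y x x = 0)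
    (w x y : A) : altKf w x y y = 0 := by
  simp [altKf, hr]

theorem altKf_23
    (hl : ∀ x y : A, altAssoc x x y = 0) (hr : ∀ x y : A, altAssoc y x x = 0)
    (w x z : A) : altKf w x x z = 0 := by
  rw [altKf_cyc hl hr, altKf_34 hl hr, neg_zero]

theorem altKf_12
    (hl : ∀ x y : A, altAssoc x x y = 0) (hr : ∀ x y : A, altAssoc y x x = 0)
    (x y z : A) : altKf x x y z = 0 := by
  rw [altKf_cyc hl hr, altKf_23 hl hr, neg_zero]

theorem altKf_13
    (hl : ∀ x y : A, altAssoc x x y = 0) (hr : ∀ x y : A, altAssoc y x x = 0)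
    (x y z : A) : altKf x y x z = 0 := by
  have h := altKf_12 hl hr (x + y) x z
  have h1 := altKf_12 hl hr x x z
  have h2 := altKf_12 hl hr y x z
  have h3 := altKf_23 hl hr y x z
  simp only [altKf, altAssoc_add1, add_mul, mul_add] at *
  linear_combination (norm := abel) h - h1 - h2 - h3

theorem alt_J
    (hl : ∀ x y : A, altAssoc x x y = 0) (hr : ∀ x y : A, altAssoc y x x = 0)
    (x y z : A) : altAssoc y z (x * x) = x * altAssoc y z x + altAssoc y z x * x := by
  have h := altKf_12 hl hr x y z
  simp only [altKf] at h
  rw [alt_cyc hl hr (x * x), alt_cyc hl hr x] at h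
  linear_combination (norm := abel) h

theorem alt_J2
    (hl : ∀ x y : A, altAssoc x x y = 0) (hr : ∀ x y : A, altAssoc y x x = 0)
    (c u y z : A) : altAssoc y z (c * u + u * c) =
    c * altAssoc y z u + altAssoc y z u * c + (u * altAssoc y z c + altAssoc y z c * u) := by
  have h := alt_J hl hr (c + u) y z
  have h1 := alt_J hl hr c y z
  have h2 := alt_J hl hr u y z
  simp only [altAssoc_add3, add_mul, mul_add] at *
  linear_combination (norm := abel) h - h1 - h2

theorem alt_E1
    (hl : ∀ x y : A, altAssoc x x y = 0) (hr : ∀ x y : A, altAssoc y x x = 0)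
    (a y u : A) : altAssoc a y (u * a) = a * altAssoc a y u := by
  have h := altKf_23 hl hr u a y
  simp only [altKf, hl, zero_mul, sub_zero] at h
  rw [alt_cyc hl hr (u * a), alt_cyc hl hr u] at h
  exact sub_eq_zero.mp h

theorem alt_E2
    (hl : ∀ x y : A, altAssoc x x y = 0) (hr : ∀ x y : A, altAssoc y x x = 0)
    (a y u : A) : altAssoc a y (a * u) = altAssoc a y u * a := by
  have h := altKf_13 hl hr a u y
  simp only [altKf, hl, mul_zero, sub_zero] at h
  rw [alt_cyc hl hr (a * u), alt_cyc hl hr u] at h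
  exact sub_eq_zero.mp h

theorem alt_E3
    (hl : ∀ x y : A, altAssoc x x y = 0) (hr : ∀ x y : A, altAssoc y x x = 0)
    (a y u : A) : altAssoc a y (u * y) = y * altAssoc a y u := by
  rw [alt_s12 hl, alt_E1 hl hr, alt_s12 hl a y u, mul_neg]

theorem alt_E4
    (hl : ∀ x y : A, altAssoc x x y = 0) (hr : ∀ x y : A, altAssoc y x x = 0)
    (a y u : A) : altAssoc a y (y * u) = altAssoc a y u * y := by
  rw [alt_s12 hl, alt_E2 hl hr, alt_s12 hl a y u, neg_mul]

/-- Multiplying an associator `(a,y,u)` by `[a,y]`. -/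
theorem alt_K
    (hl : ∀ x y : A, altAssoc x x y = 0) (hr : ∀ x y : A, altAssoc y x x = 0)
    (a y u : A) : altComm a y * altAssoc a y u + altAssoc a y u * altComm a y
    + altAssoc a y (altComm a y * u + u * altComm a y) = 0 := by
  -- pure expansion: the sum of associators in the arguments `a`, `y`, `t` vanishes
  have key : ∀ t : A, altComm a y * t + t * altComm a y
      = a * (y * t) - y * (a * t) + ((t * a) * y - (t * y) * a) := by
    intro t
    have e1 : altAssoc a y t - altAssoc y a t - altAssoc t a y + altAssoc t y a = 0 := by
      rw [alt_cyc hl hr t a y, alt_cyc hl hr t y a, sub_add]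
      abel
    simp only [altAssoc, altComm, sub_mul, mul_sub] at *
    linear_combination (norm := abel) e1
  rw [key (altAssoc a y u), key u]
  simp only [altAssoc_add3, altAssoc_sub3, alt_E1 hl hr, alt_E2 hl hr, alt_E3 hl hr, alt_E4 hl hr]
  abel

theorem alt_N
    (hl : ∀ x y : A, altAssoc x x y = 0) (hr : ∀ x y : A, altAssoc y x x = 0)
    (h2 : ∀ t : A, t + t = 0 → t = 0) (a y u : A) :
    altComm a y * altAssoc a y u + altAssoc a y u * altComm a y = 0 := by
  apply h2
  have h := alt_K hl hr a y u
  rw [alt_J2 hl hr] at h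
  have hc : altAssoc a y (altComm a y) = 0 := by
    rw [altComm, altAssoc_sub3, alt_E2 hl hr, alt_E1 hl hr, hr]; simp
  simpa [hc] using h

theorem alt_G
    (hl : ∀ x y : A, altAssoc x x y = 0) (hr : ∀ x y : A, altAssoc y x x = 0)
    (h2 : ∀ t : A, t + t = 0 → t = 0) (a x y : A) :
    altAssoc a x (altComm a y * altComm a y) = 0 := by
  have h : altAssoc a x (altComm a y) = altAssoc a y (x * a - a * x) := by
    rw [altComm, altAssoc_sub3, altAssoc_sub3, alt_E2 hl hr, alt_E1 hl hr, alt_E2 hl hr,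
      alt_E1 hl hr, alt_s23 hr a x y, neg_mul, mul_neg]
    abel
  rw [alt_J hl hr, h, alt_N hl hr h2]

theorem alt_G2
    (hl : ∀ x y : A, altAssoc x x y = 0) (hr : ∀ x y : A, altAssoc y x x = 0)
    (h2 : ∀ t : A, t + t = 0 → t = 0) (a x y z : A) :
    altAssoc a x (altComm a y * altComm a z + altComm a z * altComm a y) = 0 := by
  have h := alt_G hl hr h2 a x (y + z)
  have h1 := alt_G hl hr h2 a x y
  have h3 := alt_G hl hr h2 a x z
  have e : altComm a (y + z) = altComm a y + altComm a z := by
    simp only [altComm, mul_add, add_mul]; abel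
  rw [e] at h
  simp only [altAssoc_add3, add_mul, mul_add] at *
  linear_combination (norm := abel) h - h1 - h3

/-- Commutation is a derivation of the Jordan product. -/
theorem alt_der
    (hl : ∀ x y : A, altAssoc x x y = 0) (hr : ∀ x y : A, altAssoc y x x = 0)
    (a w y : A) : altComm (a * w + w * a) y =
    (a * altComm w y + altComm w y * a) + (altComm a y * w + w * altComm a y) := by
  have e1 : altAssoc a w y - altAssoc a y w + altAssoc y a w
      + (altAssoc w a y - altAssoc w y a + altAssoc y w a) = 0 := by
    rw [alt_s12 hl w a y, alt_s23 hr a y w, alt_s12 hl y a w, alt_s12 hl w y a,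
      alt_s23 hr y w a, alt_s12 hl y a w, alt_s23 hr a y w]
    abel
  simp only [altAssoc, altComm, sub_mul, mul_sub, add_mul, mul_add] at *
  linear_combination (norm := abel) e1

end helpers

theorem stmt_18 {F : Type*} [Field F] [CharZero F]
    [Module F A] [SMulCommClass F A A] [IsScalarTower F A A]
    (alt_left : ∀ x y : A, altAssoc x x y = 0)
    (alt_right : ∀ x y : A, altAssoc y x x = 0)
    (a x y z : A) :
    altAssoc (a * a) x (altComm (altComm a z) y) = altAssoc a x (altComm (altComm (a * a) z) y) := by 
  have h2 : ∀ t : A, t + t = 0 → t = 0 := by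
    intro t ht
    have h : (2 : F) • t = 0 := by rw [two_smul, ht]
    exact (smul_eq_zero.mp h).resolve_left two_ne_zero
  have e : altComm (a * a) z = a * altComm a z + altComm a z * a := by
    have h1 := alt_left a z
    have h3 := alt_right a z
    have h4 : altAssoc a z a = 0 := by rw [alt_s12 alt_left, alt_right, neg_zero]
    simp only [altAssoc, altComm, sub_mul, mul_sub] at *
    linear_combination (norm := abel) h1 + h3 - h4
  rw [e, alt_der alt_left alt_right, altAssoc_add3, alt_G2 alt_left alt_right h2, add_zero,
    altAssoc_add3, alt_E1 alt_left alt_right, alt_E2 alt_left alt_right,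
    alt_cyc alt_left alt_right (a * a), alt_J alt_left alt_right,
    ← alt_cyc alt_left alt_right a, add_comm]
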